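/- arXiv:2201.12949 — 2 statements merged into one kernel-verified Lean document; each statement's English description precedes it below -/
import Mathlib

section
/- Let w be a permutation of {1,…,n} and let i be an index with |w(i) − i| = 1. For a ≠ i write a' = a if a < i and a' = a − 1 if a > i. Then for every a ≠ i: if (a,i) (when a<i) or (i,a) (when a>i) is an inversion of w, then |fl_i(w)(a') − a'| = |w(a) − a| − 1; otherwise |fl_i(w)(a') − a'| = |w(a) − a|. -/
/-- The (Coxeter) length of a permutation: its number of inversions,
i.e. pairs `(a,b)` with `a < b` and `w a > w b`. -/
def invLen {n : ℕ} (w : Equiv.Perm (Fin n)) : ℕ :=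
  (Finset.univ.filter (fun p : Fin n × Fin n => p.1 < p.2 ∧ w p.2 < w p.1)).card

/-- The number of cycles in the cycle decomposition of `w`,
where fixed points count as cycles. -/
def numCycles {n : ℕ} (w : Equiv.Perm (Fin n)) : ℕ :=
  w.cycleType.card + (Finset.univ.filter (fun i : Fin n => w i = i)).card

/-- The reflection length of a permutation of `{1,…,n}`: `n` minus the number of
cycles in its cycle decomposition (fixed points counting as cycles). -/
def reflLen {n : ℕ} (w : Equiv.Perm (Fin n)) : ℕ :=
  n - numCycles w

/-- The total displacement `td(w) = Σ_i |w(i) - i|`. -/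
def totalDisp {n : ℕ} (w : Equiv.Perm (Fin n)) : ℕ :=
  ∑ i : Fin n, ((w i : ℤ) - (i : ℤ)).natAbs

/-- A permutation is shallow if `ℓ(w) + ℓ_T(w) = td(w)`. -/
def IsShallow {n : ℕ} (w : Equiv.Perm (Fin n)) : Prop :=
  invLen w + reflLen w = totalDisp w

/-- The `i`-th flattening of `w`: remove the `i`-th entry of the one-line notation
and renumber down by one every entry greater than `w i`.  Position `k` of `Fin n`
corresponds to position `i.succAbove k` of `Fin (n+1)`, and value `m` corresponds
to value `(w i).succAbove m`; this is implemented by deleting the point `i` from the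
source and `w i` from the target via `finSuccEquiv'`. -/
def flatten {n : ℕ} (w : Equiv.Perm (Fin (n + 1))) (i : Fin (n + 1)) : Equiv.Perm (Fin n) :=
  Equiv.removeNone ((finSuccEquiv' i).symm.trans (w.trans (finSuccEquiv' (w i))))

/-- `v` has a left-to-right maximum at position `j` if `v j > v i` for all `i < j`. -/
def LeftToRightMaxAt {m : ℕ} (v : Equiv.Perm (Fin m)) (j : Fin m) : Prop :=
  ∀ i : Fin m, i < j → v i < v j

/-- `v` has a right-to-left minimum at position `j` if `v j < v i` for all `i > j`. -/
def RightToLeftMinAt {m : ℕ} (v : Equiv.Perm (Fin m)) (j : Fin m) : Prop :=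
  ∀ i : Fin m, j < i → v j < v i

/-- The flattening is characterized by commuting with the order embeddings that skip `i`
in the source and `w i` in the target. -/
theorem succAbove_flatten {n : ℕ} (w : Equiv.Perm (Fin (n + 1))) (i : Fin (n + 1)) (k : Fin n) :
    (w i).succAbove (flatten w i k) = w (i.succAbove k) := by
  have hne : w (i.succAbove k) ≠ w i := fun h => Fin.succAbove_ne i k (w.injective h)
  obtain ⟨m, hm⟩ := Fin.exists_succAbove_eq hne
  have hsome : ((finSuccEquiv' i).symm.trans (w.trans (finSuccEquiv' (w i)))) (some k) = some m := by
    simp [← hm]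
  have hfl : some (flatten w i k) = some m :=
    (Equiv.removeNone_some _ ⟨m, hsome⟩).trans hsome
  rw [Option.some_injective _ hfl, hm]

/-- Suppose `|w i - i| = 1`.  For `a ≠ i`, write `a' = a` if `a < i` and `a' = a - 1`
if `a > i`.  If `(a,i)` (when `a < i`) or `(i,a)` (when `a > i`) is an inversion of `w`,
then `|fl_i(w)(a') - a'| = |w a - a| - 1`; otherwise `|fl_i(w)(a') - a'| = |w a - a|`. -/
theorem abs_displacement_flatten_of_near {n : ℕ} (w : Equiv.Perm (Fin (n + 1)))
    (i : Fin (n + 1)) (hi : ((w i : ℤ) - (i : ℤ)).natAbs = 1)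
    (a : Fin (n + 1)) (ha : a ≠ i) (a' : Fin n)
    (ha' : (a' : ℕ) = if (a : ℕ) < (i : ℕ) then (a : ℕ) else (a : ℕ) - 1) :
    (((a < i ∧ w i < w a) ∨ (i < a ∧ w a < w i)) →
        |((flatten w i a' : ℤ)) - (a' : ℤ)| = |((w a : ℤ)) - (a : ℤ)| - 1)
    ∧ (¬((a < i ∧ w i < w a) ∨ (i < a ∧ w a < w i)) →
        |((flatten w i a' : ℤ)) - (a' : ℤ)| = |((w a : ℤ)) - (a : ℤ)|) := by
  have hsucc : i.succAbove a' = a := by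
    simp only [Fin.succAbove, Fin.lt_def, Fin.ext_iff, Fin.val_castSucc] at ha ⊢
    split_ifs at ha' ⊢ <;> simp only [Fin.val_succ, Fin.val_castSucc] <;> omega
  have hval := congrArg Fin.val (succAbove_flatten w i a')
  have hwa : w a ≠ w i := fun h => ha (w.injective h)
  rw [hsucc] at hval
  simp only [Fin.succAbove, Fin.lt_def, Fin.val_castSucc] at hval
  simp only [Fin.lt_def, ne_eq, Fin.ext_iff, Int.abs_eq_natAbs] at ha hwa ⊢
  split_ifs at hval ha' <;> simp only [Fin.val_succ, Fin.val_castSucc] at hval <;> omega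
end

section
/- For n ≥ 0 let a_n denote the number of shallow permutations of {1,…,n} (with a_0 = 1), and let G = Σ_{n≥0} a_n x^n be the corresponding formal power series with rational coefficients. Then G satisfies x²·G³ + (x² − 3x + 1)·G² + (3x − 2)·G + 1 = 0. -/
/-- The labels that can replace the label `m + 1`, other than the two copies of `m + 2`. -/
def innerLabels : ℕ → List ℕ
  | 0 => []
  | 1 => []
  | m + 2 => (m + 2) :: innerLabels (m + 1)

/-- The labels that can replace a given label. -/
def succLabels : ℕ → List ℕ
  | 0 => [1]
  | m + 1 => (m + 2) :: (m + 2) :: innerLabels (m + 1)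

/-- The stacks obtained by popping some labels and then replacing the new top label. -/
def popChildren : List ℕ → List (List ℕ)
  | [] => []
  | m :: s => (succLabels m).map (· :: s) ++ popChildren s

/-- The number of paths of a given length starting at a stack, each step either pushing `0` or
moving to one of the `popChildren`. -/
def countPaths : ℕ → List ℕ → ℕ
  | 0, _ => 1
  | k + 1, s => countPaths k (0 :: s) + ((popChildren s).map (countPaths k)).sum

/-- The generating function of `countPaths`. -/
noncomputable def pathSeries (s : List ℕ) : PowerSeries ℚ :=
  PowerSeries.mk fun k => (countPaths k s : ℚ)

/-- The contribution of the part `s` of a stack to its `pathSeries`. -/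
noncomputable def popSeries (s : List ℕ) : PowerSeries ℚ :=
  1 + PowerSeries.X * ((popChildren s).map pathSeries).sum

lemma pathSeries_eq (s : List ℕ) :
    pathSeries s = PowerSeries.X * pathSeries (0 :: s) + popSeries s := by
  ext k
  rw [popSeries]
  cases k with
  | zero => simp [pathSeries, countPaths]
  | succ k =>
    simp only [map_add, PowerSeries.coeff_succ_X_mul, PowerSeries.coeff_one, map_list_sum,
      List.map_map]
    simp [pathSeries, countPaths, Function.comp_def, Nat.cast_list_sum]

lemma popChildren_append (t s : List ℕ) :
    popChildren (t ++ s) = (popChildren t).map (· ++ s) ++ popChildren s := by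
  induction t with
  | nil => simp [popChildren]
  | cons m t ih => simp [popChildren, ih, Function.comp_def]

lemma PowerSeries.eq_zero_of_forall_X_pow_dvd {f : PowerSeries ℚ}
    (h : ∀ k, PowerSeries.X ^ k ∣ f) : f = 0 := by
  ext k
  simpa using PowerSeries.X_pow_dvd_iff.1 (h (k + 1)) k (by lia)

lemma pathSeries_append (t s : List ℕ) :
    pathSeries (t ++ s) = pathSeries t * popSeries s := by
  rw [← sub_eq_zero]
  refine PowerSeries.eq_zero_of_forall_X_pow_dvd fun k => ?_
  induction k generalizing t with
  | zero => simp
  | succ k ih =>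
    have key : pathSeries (t ++ s) - pathSeries t * popSeries s =
        PowerSeries.X * ((pathSeries ((0 :: t) ++ s) - pathSeries (0 :: t) * popSeries s) +
          ((popChildren t).map fun c => pathSeries (c ++ s) - pathSeries c * popSeries s).sum) := by
      have hsub : ∀ l : List (List ℕ),
          (l.map fun c => pathSeries (c ++ s) - pathSeries c * popSeries s).sum =
            (l.map fun c => pathSeries (c ++ s)).sum - (l.map pathSeries).sum * popSeries s := by
        intro l
        induction l with
        | nil => simp
        | cons c l ih =>
          simp only [List.map_cons, List.sum_cons, ih]
          ring
      rw [hsub, pathSeries_eq (t ++ s), pathSeries_eq t]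
      simp only [popSeries, popChildren_append, List.map_append, List.sum_append, List.map_map,
        Function.comp_def, List.cons_append]
      ring
    rw [key, pow_succ']
    refine mul_dvd_mul_left _ (dvd_add (ih _) (List.dvd_sum fun x hx => ?_))
    obtain ⟨c, -, rfl⟩ := List.mem_map.1 hx
    exact ih c

lemma popSeries_singleton (m : ℕ) :
    popSeries [m] = 1 + PowerSeries.X * pathSeries [] *
      ((succLabels m).map fun c => popSeries [c]).sum := by
  have h : ∀ c, pathSeries [c] = pathSeries [] * popSeries [c] := fun c =>
    pathSeries_append [] [c]
  rw [popSeries]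
  simp [popChildren, Function.comp_def, h, List.sum_map_mul_left, mul_assoc]

lemma popSeries_singleton_sub (m : ℕ) :
    popSeries [m + 1] - popSeries [m] =
      PowerSeries.X * pathSeries [] * (2 * popSeries [m + 2] - popSeries [m + 1]) := by
  have e1 := popSeries_singleton (m + 1)
  have e0 := popSeries_singleton m
  rcases m with _ | m <;>
  · simp only [succLabels, innerLabels, List.map_cons, List.map_nil, List.sum_cons, List.sum_nil,
      zero_add] at e0 e1 ⊢
    linear_combination e1 - e0

lemma popSeries_geometric (m : ℕ) :
    popSeries [m + 1] * popSeries [0] - popSeries [m] * popSeries [1] = 0 := by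
  set y := PowerSeries.X * pathSeries [] with hy
  set d : ℕ → PowerSeries ℚ := fun m =>
    popSeries [m + 1] * popSeries [0] - popSeries [m] * popSeries [1] with hd
  have h0 : d 0 = 0 := by simp only [hd, zero_add]; ring
  have hrec : ∀ m, d (m + 1) = d m +
      PowerSeries.X * (pathSeries [] * (2 * d (m + 2) - d (m + 1))) := by
    intro m
    have e1 := popSeries_singleton_sub m
    have e2 := popSeries_singleton_sub (m + 1)
    simp only [hd]
    linear_combination popSeries [0] * e2 - popSeries [1] * e1
  refine PowerSeries.eq_zero_of_forall_X_pow_dvd (f := d m) fun k => ?_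
  induction k generalizing m with
  | zero => simp
  | succ k ih =>
    induction m with
    | zero => simp [h0]
    | succ m ihm =>
      rw [hrec m, pow_succ']
      rw [pow_succ'] at ihm
      exact dvd_add ihm (mul_dvd_mul_left _ (Dvd.dvd.mul_left
        (dvd_sub (Dvd.dvd.mul_left (ih _) _) (ih _)) _))

lemma pathSeries_nil_cubic :
    PowerSeries.X ^ 2 * pathSeries [] ^ 3 +
      (PowerSeries.X ^ 2 - 3 * PowerSeries.X + 1) * pathSeries [] ^ 2
      + (3 * PowerSeries.X - 2) * pathSeries [] + 1 = 0 := by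
  have hG : pathSeries [] = PowerSeries.X * (pathSeries [] * popSeries [0]) + 1 := by
    rw [← pathSeries_append]
    simpa [popSeries, popChildren] using pathSeries_eq []
  have h0 := popSeries_singleton 0
  have h1 := popSeries_singleton 1
  have h2 := popSeries_geometric 1
  simp only [succLabels, innerLabels, List.map_cons, List.map_nil, List.sum_cons, List.sum_nil,
    add_zero, zero_add, Nat.reduceAdd] at h0 h1 h2
  generalize popSeries [0] = a at *
  generalize popSeries [1] = b at *
  generalize popSeries [2] = c at *
  generalize pathSeries [] = G at *
  generalize (PowerSeries.X : PowerSeries ℚ) = x at *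
  have hq : a ^ 2 - 3 * a + 2 + x * G * a = 0 := by
    linear_combination (2 * (a - 1 + x * G * b) - a) * h0 - x * G * a * h1 - 2 * (x * G) ^ 2 * h2
  linear_combination (x * G) ^ 2 * hq +
    (G - 1 + x * G * a - 3 * (x * G) + (x * G) ^ 2) * hG

/-- `Staircase s A C` says that the decreasing lists of points `A` (an upper staircase) and `C`
(a lower staircase) have, from top to bottom, connected components with numbers of crossing
pairs given by `s`; here points `p` of `A` and `r` of `C` cross if `p` is to the upper left
of `r`. The label `0` stands for a point belonging to both lists. -/
inductive Staircase : List ℕ → List (ℕ × ℕ) → List (ℕ × ℕ) → Prop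
  | nil : Staircase [] [] []
  | point {s A C} (j : ℕ × ℕ) (h : Staircase s A C)
      (hj : ∀ i, i ∈ A ∨ i ∈ C → i.1 < j.1 ∧ i.2 < j.2) : Staircase (0 :: s) (j :: A) (j :: C)
  | pair {s A C} (p r : ℕ × ℕ) (h : Staircase s A C) (h1 : p.1 < r.1) (h2 : r.2 < p.2)
      (hj : ∀ i, i ∈ A ∨ i ∈ C → i.1 < p.1 ∧ i.2 < r.2) : Staircase (1 :: s) (p :: A) (r :: C)
  | lower {m s A C} (p r : ℕ × ℕ) (h : Staircase ((m + 1) :: s) (p :: A) C)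
      (h1 : p.1 < r.1) (h2 : r.2 < p.2)
      (hj : ∀ i, i ∈ A ∨ i ∈ C → i.1 < r.1 ∧ i.2 < r.2) :
      Staircase ((m + 2) :: s) (p :: A) (r :: C)
  | upper {m s A C} (p r : ℕ × ℕ) (h : Staircase ((m + 1) :: s) A (r :: C))
      (h1 : p.1 < r.1) (h2 : r.2 < p.2)
      (hj : ∀ i, i ∈ A ∨ i ∈ C → i.1 < p.1 ∧ i.2 < p.2) :
      Staircase ((m + 2) :: s) (p :: A) (r :: C)

namespace Staircase

lemma pairwise {s : List ℕ} {A C : List (ℕ × ℕ)} (h : Staircase s A C) :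
    A.Pairwise (fun a b => b.1 < a.1 ∧ b.2 < a.2) ∧
      C.Pairwise (fun a b => b.1 < a.1 ∧ b.2 < a.2) := by
  induction h with
  | nil => simp
  | point j h hj ih => simp only [List.pairwise_cons]; grind
  | pair p r h h1 h2 hj ih => simp only [List.pairwise_cons]; grind
  | lower p r h h1 h2 hj ih => simp only [List.pairwise_cons] at ih ⊢; grind
  | upper p r h h1 h2 hj ih => simp only [List.pairwise_cons] at ih ⊢; grind

lemma exists_top {m : ℕ} {s : List ℕ} {A C : List (ℕ × ℕ)} (h : Staircase ((m + 1) :: s) A C) :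
    ∃ p A₀ r C₀, A = p :: A₀ ∧ C = r :: C₀ ∧ p.1 < r.1 ∧ r.2 < p.2 := by
  cases h <;> exact ⟨_, _, _, _, rfl, rfl, by assumption, by assumption⟩

lemma raise {m : ℕ} {s : List ℕ} {p : ℕ × ℕ} {A C : List (ℕ × ℕ)}
    (h : Staircase ((m + 1) :: s) (p :: A) C) {y : ℕ} (hy : p.2 ≤ y) :
    Staircase ((m + 1) :: s) ((p.1, y) :: A) C := by
  generalize ht : (m + 1) :: s = t at h
  generalize hB : p :: A = B at h
  induction h generalizing m with
  | nil => cases hB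
  | point => simp at ht
  | pair p r h h1 h2 hj ih => cases hB; cases ht; exact .pair _ _ h h1 (by grind) hj
  | lower p r h h1 h2 hj ih => cases hB; cases ht; exact .lower _ _ (ih rfl rfl) h1 (by grind) hj
  | upper p r h h1 h2 hj ih => cases hB; cases ht; exact .upper _ _ h h1 (by grind) (by grind)

lemma shift {m : ℕ} {s : List ℕ} {r : ℕ × ℕ} {A C : List (ℕ × ℕ)}
    (h : Staircase ((m + 1) :: s) A (r :: C)) {x : ℕ} (hx : r.1 ≤ x) :
    Staircase ((m + 1) :: s) A ((x, r.2) :: C) := by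
  generalize ht : (m + 1) :: s = t at h
  generalize hB : r :: C = B at h
  induction h generalizing m with
  | nil => cases hB
  | point => simp at ht
  | pair p r h h1 h2 hj ih => cases hB; cases ht; exact .pair _ _ h (by grind) h2 hj
  | lower p r h h1 h2 hj ih => cases hB; cases ht; exact .lower _ _ h (by grind) h2 (by grind)
  | upper p r h h1 h2 hj ih => cases hB; cases ht; exact .upper _ _ (ih rfl rfl) (by grind) h2 hj

end Staircase

/-- The staircases obtained from `A` and `C` by moving the point `q` up to height `n` and right
to position `n` have the components `c`. -/
def SplitAt (n : ℕ) (A C : List (ℕ × ℕ)) (q : ℕ × ℕ) (c : List ℕ) : Prop :=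
  Staircase c ((q.1, n) :: A.filter (·.1 < q.1)) ((n, q.2) :: C.filter (·.2 < q.2))

/-- Splitting the staircases `A` and `C` at the points of `A₀` and `C₀` gives
the list `S` of components. -/
def Splits (n : ℕ) (A C A₀ C₀ : List (ℕ × ℕ)) (S : List (List ℕ)) : Prop :=
  ∃ T : List ((ℕ × ℕ) × List ℕ), (T.map Prod.fst).Nodup ∧
    (∀ q, q ∈ T.map Prod.fst ↔ q ∈ A₀ ∨ q ∈ C₀) ∧ T.map Prod.snd = S ∧
    ∀ x ∈ T, SplitAt n A C x.1 x.2

namespace Splits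

variable {n : ℕ} {A C A₀ C₀ A₁ C₁ : List (ℕ × ℕ)} {S : List (List ℕ)}

lemma cons (h : Splits n A C A₀ C₀ S) {q : ℕ × ℕ} {c : List ℕ} (hq : SplitAt n A C q c)
    (hA : q ∉ A₀) (hC : q ∉ C₀) (h₁ : ∀ x, x ∈ A₁ ∨ x ∈ C₁ ↔ x = q ∨ x ∈ A₀ ∨ x ∈ C₀) :
    Splits n A C A₁ C₁ (c :: S) := by
  obtain ⟨T, hT, hm, rfl, hs⟩ := h
  refine ⟨(q, c) :: T, ?_, ?_, rfl, ?_⟩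
  · rw [List.map_cons, List.nodup_cons, hm]
    tauto
  · intro x
    rw [List.map_cons, List.mem_cons, hm, h₁]
  · intro x hx
    rcases List.mem_cons.1 hx with rfl | hx
    exacts [hq, hs x hx]

lemma cons_left (h : Splits n A C A₀ C₀ S) (p : ℕ × ℕ) (hp : ∀ q, q ∈ A₀ ∨ q ∈ C₀ → q.1 ≤ p.1) :
    Splits n (p :: A) C A₀ C₀ S := by
  obtain ⟨T, hT, hm, hS, hs⟩ := h
  refine ⟨T, hT, hm, hS, fun x hx => ?_⟩
  have := hp x.1 ((hm _).1 (List.mem_map_of_mem hx))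
  rw [SplitAt, List.filter_cons_of_neg (by simpa using this)]
  exact hs x hx

lemma cons_right (h : Splits n A C A₀ C₀ S) (r : ℕ × ℕ)
    (hr : ∀ q, q ∈ A₀ ∨ q ∈ C₀ → q.2 ≤ r.2) :
    Splits n A (r :: C) A₀ C₀ S := by
  obtain ⟨T, hT, hm, hS, hs⟩ := h
  refine ⟨T, hT, hm, hS, fun x hx => ?_⟩
  have := hr x.1 ((hm _).1 (List.mem_map_of_mem hx))
  rw [SplitAt, List.filter_cons_of_neg (by simpa using this)]
  exact hs x hx

end Splits

lemma Staircase.splitAt {n : ℕ} {D A E C : List (ℕ × ℕ)} {q : ℕ × ℕ} {c : List ℕ}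
    (h : Staircase c ((q.1, n) :: A) ((n, q.2) :: C))
    (hD : ∀ x ∈ D, q.1 ≤ x.1) (hA : ∀ x ∈ A, x.1 < q.1)
    (hE : ∀ x ∈ E, q.2 ≤ x.2) (hC : ∀ x ∈ C, x.2 < q.2) :
    SplitAt n (D ++ A) (E ++ C) q c := by
  have h1 : D.filter (·.1 < q.1) = [] := List.filter_eq_nil_iff.2 (by simpa using hD)
  have h2 : A.filter (·.1 < q.1) = A := List.filter_eq_self.2 (by simpa using hA)
  have h3 : E.filter (·.2 < q.2) = [] := List.filter_eq_nil_iff.2 (by simpa using hE)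
  have h4 : C.filter (·.2 < q.2) = C := List.filter_eq_self.2 (by simpa using hC)
  rwa [SplitAt, List.filter_append, List.filter_append, h1, h2, h3, h4]

namespace Staircase

lemma splitAt_upper {n m : ℕ} {s : List ℕ} {p r : ℕ × ℕ} {A C D : List (ℕ × ℕ)}
    (h : Staircase ((m + 1) :: s) (p :: A) (r :: C))
    (hn : ∀ q, q ∈ p :: A ∨ q ∈ r :: C → q.1 < n ∧ q.2 < n) (hD : ∀ q ∈ D, p.1 ≤ q.1) :
    SplitAt n (D ++ p :: A) (r :: C) p ((m + 2) :: s) := by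
  obtain ⟨p', A', r', C', h1, h2, hpr, hrp⟩ := h.exists_top
  cases h1
  cases h2
  have hpw := h.pairwise
  simp only [List.pairwise_cons] at hpw
  rw [List.append_cons]
  refine Staircase.splitAt (E := [])
    (.lower _ _ (h.raise (y := n) ?_) ?_ ?_ ?_) ?_ ?_ ?_ ?_
  all_goals grind

lemma splitAt_lower {n m : ℕ} {s : List ℕ} {p r : ℕ × ℕ} {A C D : List (ℕ × ℕ)}
    (h : Staircase ((m + 1) :: s) (p :: A) (r :: C))
    (hn : ∀ q, q ∈ p :: A ∨ q ∈ r :: C → q.1 < n ∧ q.2 < n) (hD : ∀ q ∈ D, r.2 ≤ q.2) :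
    SplitAt n (p :: A) (D ++ r :: C) r ((m + 2) :: s) := by
  obtain ⟨p', A', r', C', h1, h2, hpr, hrp⟩ := h.exists_top
  cases h1
  cases h2
  have hpw := h.pairwise
  simp only [List.pairwise_cons] at hpw
  rw [List.append_cons]
  refine Staircase.splitAt (D := [])
    (.upper _ _ (h.shift (x := n) ?_) ?_ ?_ ?_) ?_ ?_ ?_ ?_
  all_goals grind

lemma splits_of_inner {n m : ℕ} {s : List ℕ} {p r : ℕ × ℕ} {A C : List (ℕ × ℕ)}
    (h : Staircase ((m + 1) :: s) (p :: A) (r :: C))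
    (hn : ∀ q, q ∈ p :: A ∨ q ∈ r :: C → q.1 < n ∧ q.2 < n)
    (hi : Splits n (p :: A) (r :: C) A C ((innerLabels (m + 1)).map (· :: s) ++ popChildren s)) :
    Splits n (p :: A) (r :: C) (p :: A) (r :: C) (popChildren ((m + 1) :: s)) := by
  obtain ⟨p', A', r', C', h1, h2, hpr, hrp⟩ := h.exists_top
  cases h1
  cases h2
  have hpw := h.pairwise
  simp only [List.pairwise_cons] at hpw
  have hl := hi.cons (A₁ := A) (C₁ := r :: C) (h.splitAt_lower hn (D := []) (by simp))
    (by grind) (by grind) (by grind)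
  exact hl.cons (h.splitAt_upper hn (D := []) (by simp)) (by grind) (by grind) (by grind)

lemma splits_aux {n : ℕ} {s : List ℕ} {A C : List (ℕ × ℕ)} (h : Staircase s A C)
    (hn : ∀ q, q ∈ A ∨ q ∈ C → q.1 < n ∧ q.2 < n) :
    Splits n A C A C (popChildren s) ∧ ∀ m s', s = (m + 1) :: s' →
      Splits n A C A.tail C.tail ((innerLabels (m + 1)).map (· :: s') ++ popChildren s') := by
  induction h with
  | nil => exact ⟨⟨[], by simp [popChildren]⟩, by simp⟩
  | @point s A C j h hj ih =>
    refine ⟨?_, by simp⟩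
    have hs := (ih (by grind)).1
    refine ((hs.cons_left j (by grind)).cons_right j (by grind)).cons
      (Staircase.splitAt (q := j) (D := [j]) (E := [j]) (.pair _ _ h ?_ ?_ ?_) ?_ ?_ ?_ ?_) ?_ ?_ ?_
    all_goals grind
  | @pair s A C p r h h1 h2 hj ih =>
    have hi : Splits n (p :: A) (r :: C) A C (popChildren s) :=
      ((ih (by grind)).1.cons_left p (by grind)).cons_right r (by grind)
    refine ⟨splits_of_inner (.pair _ _ h h1 h2 hj) hn hi, ?_⟩
    rintro m s' ⟨⟩
    exact hi
  | @lower m s A C p r h h1 h2 hj ih =>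
    obtain ⟨p', A', r₀, C₀, e1, rfl, hpr, hrp⟩ := h.exists_top
    cases e1
    have hpw := h.pairwise
    simp only [List.pairwise_cons] at hpw
    have hi : Splits n (p :: A) (r :: r₀ :: C₀) A (r₀ :: C₀)
        ((innerLabels (m + 2)).map (· :: s) ++ popChildren s) :=
      (((ih (by grind)).2 _ _ rfl).cons_right r (by grind)).cons
        (h.splitAt_lower (by grind) (D := [r]) (by grind)) (by grind) (by grind) (by grind)
    refine ⟨splits_of_inner (.lower _ _ h h1 h2 hj) hn hi, ?_⟩
    rintro m s' ⟨⟩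
    exact hi
  | @upper m s A C p r h h1 h2 hj ih =>
    obtain ⟨p₀, A₀, r', C', rfl, e1, hpr, hrp⟩ := h.exists_top
    cases e1
    have hpw := h.pairwise
    simp only [List.pairwise_cons] at hpw
    have hi : Splits n (p :: p₀ :: A₀) (r :: C) (p₀ :: A₀) C
        ((innerLabels (m + 2)).map (· :: s) ++ popChildren s) :=
      (((ih (by grind)).2 _ _ rfl).cons_left p (by grind)).cons
        (h.splitAt_upper (by grind) (D := [p]) (by grind)) (by grind) (by grind) (by grind)
    refine ⟨splits_of_inner (.upper _ _ h h1 h2 hj) hn hi, ?_⟩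
    rintro m s' ⟨⟩
    exact hi

lemma splits {n : ℕ} {s : List ℕ} {A C : List (ℕ × ℕ)} (h : Staircase s A C)
    (hn : ∀ q, q ∈ A ∨ q ∈ C → q.1 < n ∧ q.2 < n) :
    Splits n A C A C (popChildren s) :=
  (h.splits_aux hn).1

end Staircase

section Cycles

open Equiv Equiv.Perm

lemma numCycles_add_card_support {n : ℕ} (f : Perm (Fin n)) :
    numCycles f + f.support.card = f.cycleType.card + n := by
  have h := Finset.card_filter_add_card_filter_not (s := (Finset.univ : Finset (Fin n)))
    (fun i => f i = i)
  have h2 : Finset.univ.filter (fun i => ¬ f i = i) = f.support := by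
    ext i
    simp
  rw [h2, Finset.card_univ, Fintype.card_fin] at h
  unfold numCycles
  omega

lemma numCycles_le {n : ℕ} (f : Perm (Fin n)) : numCycles f ≤ n := by
  have h := numCycles_add_card_support f
  have h2 : f.cycleType.card ≤ f.support.card := by
    rw [← sum_cycleType]
    simpa using Multiset.card_nsmul_le_sum (s := f.cycleType) (a := 1)
      (fun x hx => (one_lt_of_mem_cycleType hx).le)
  omega

lemma numCycles_swap_mul {n : ℕ} {f : Perm (Fin n)} {x : Fin n} (hx : f x ≠ x) :
    numCycles (swap x (f x) * f) = numCycles f + 1 := by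
  set g := f.cycleOf x with hg
  have hgc : g.IsCycle := isCycle_cycleOf f hx
  have hgx : g x = f x := cycleOf_apply_self f x
  have hd : (f * g⁻¹).Disjoint g := disjoint_mul_inv_of_mem_cycleFactorsFinset
    (cycleOf_mem_cycleFactorsFinset_iff.2 (mem_support.2 hx))
  set h := f * g⁻¹ with hh
  have hf : f = g * h := by
    rw [← hd.commute.eq, hh, inv_mul_cancel_right]
  have hgxx : g x ≠ x := hgx ▸ hx
  have hprod : swap x (f x) * f = (swap x (g x) * g) * h := by
    rw [hgx, mul_assoc, ← hf]
  have key : (swap x (g x) * g).cycleType.card + g.support.card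
        = (swap x (g x) * g).support.card + 2 ∧
      (swap x (g x) * g).support ≤ g.support := by
    by_cases h2 : g (g x) = x
    · have hsw := hgc.eq_swap_of_apply_apply_eq_self hgxx h2
      have : swap x (g x) * g = 1 := by
        conv_lhs => rw [hsw]
        simp
      rw [this]
      refine ⟨?_, by simp⟩
      rw [hsw, card_support_swap hgxx.symm]
      simp
    · have hs := support_swap_mul_eq g x h2
      have hc := card_cycleType_eq_one.2 (hgc.swap_mul hgxx h2)
      have hm : x ∈ g.support := mem_support.2 hgxx
      have := Finset.card_sdiff_add_card_eq_card (Finset.singleton_subset_iff.2 hm)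
      rw [hs, hc]
      simp only [Finset.card_singleton] at this
      exact ⟨by omega, Finset.sdiff_subset⟩
  have hd2 : (swap x (g x) * g).Disjoint h :=
    disjoint_iff_disjoint_support.2
      ((disjoint_iff_disjoint_support.1 hd).symm.mono_left key.2)
  have e1 := numCycles_add_card_support f
  have e2 := numCycles_add_card_support (swap x (f x) * f)
  rw [hprod, hd2.cycleType_mul, hd2.card_support_mul, Multiset.card_add] at e2
  rw [hprod]
  rw [hf, hd.symm.cycleType_mul, hd.symm.card_support_mul, Multiset.card_add,
    card_cycleType_eq_one.2 hgc, ← hf] at e1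
  omega

end Cycles

section Children

open Equiv

variable {n : ℕ}

/-- The extension of a permutation of `Fin n` to `Fin (n + 1)` that fixes the last point. -/
def extendLast (u : Perm (Fin n)) : Perm (Fin (n + 1)) :=
  u.extendDomain (finSuccAboveEquiv (Fin.last n))

@[simp] lemma extendLast_castSucc (u : Perm (Fin n)) (i : Fin n) :
    extendLast u i.castSucc = (u i).castSucc := by
  simpa [extendLast, finSuccAboveEquiv_apply] using
    Perm.extendDomain_apply_image u (finSuccAboveEquiv (Fin.last n)) i

@[simp] lemma extendLast_last (u : Perm (Fin n)) : extendLast u (Fin.last n) = Fin.last n :=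
  Perm.extendDomain_apply_not_subtype _ _ (by simp)

/-- The permutation obtained from `u` by appending a new largest value and exchanging it with
the entry at position `j`. -/
def child (u : Perm (Fin n)) (j : Fin (n + 1)) : Perm (Fin (n + 1)) :=
  extendLast u * swap j (Fin.last n)

@[simp] lemma child_last (u : Perm (Fin n)) : child u (Fin.last n) = extendLast u := by
  simp [child, Perm.one_def]

lemma child_apply_self (u : Perm (Fin n)) (j : Fin (n + 1)) : child u j j = Fin.last n := by
  simp [child]

lemma child_castSucc_last (u : Perm (Fin n)) (i : Fin n) :
    child u i.castSucc (Fin.last n) = (u i).castSucc := by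
  simp [child]

lemma child_castSucc_of_ne (u : Perm (Fin n)) {i p : Fin n} (h : p ≠ i) :
    child u i.castSucc p.castSucc = (u p).castSucc := by
  simp [child, swap_apply_of_ne_of_ne, h]

lemma child_bijective :
    Function.Bijective fun x : Perm (Fin n) × Fin (n + 1) => child x.1 x.2 := by
  rw [Fintype.bijective_iff_injective_and_card]
  constructor
  · rintro ⟨u, j⟩ ⟨v, k⟩ h
    dsimp only at h
    obtain rfl : j = k := by
      apply (child u j).injective
      rw [child_apply_self, h, child_apply_self]
    have h2 : extendLast u = extendLast v := mul_right_cancel h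
    rw [Perm.extendDomainHom_injective _ h2]
  · simp [Fintype.card_perm, Nat.factorial_succ, mul_comm]

lemma numCycles_extendLast (u : Perm (Fin n)) : numCycles (extendLast u) = numCycles u + 1 := by

  unfold numCycles
  rw [extendLast, Perm.cycleType_extendDomain, ← extendLast]
  rw [Fin.univ_castSuccEmb, Finset.filter_cons, if_pos (extendLast_last u), Finset.card_cons,
    Finset.filter_map, Finset.card_map, add_assoc]
  simp [Function.comp_def]

lemma swap_mul_child (u : Perm (Fin n)) (i : Fin n) :
    swap (Fin.last n) (child u i.castSucc (Fin.last n)) * child u i.castSucc = extendLast u := by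
  refine Equiv.ext (Fin.lastCases ?_ fun p => ?_)
  · simp [child_castSucc_last]
  · rcases eq_or_ne p i with rfl | hp
    · simp [child_apply_self, child_castSucc_last]
    · have h1 : (u p).castSucc ≠ (u i).castSucc := by simpa using hp
      have h2 : (u p).castSucc ≠ Fin.last n := (Fin.castSucc_lt_last _).ne
      simp [child_castSucc_last, child_castSucc_of_ne u hp, swap_apply_of_ne_of_ne h2 h1]

lemma numCycles_child_castSucc (u : Perm (Fin n)) (i : Fin n) :
    numCycles (child u i.castSucc) = numCycles u := by
  have h := numCycles_swap_mul (f := child u i.castSucc) (x := Fin.last n)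
    (by rw [child_castSucc_last]; exact (Fin.castSucc_lt_last _).ne)
  rw [swap_mul_child, numCycles_extendLast] at h
  omega

lemma reflLen_extendLast (u : Perm (Fin n)) : reflLen (extendLast u) = reflLen u := by
  simp [reflLen, numCycles_extendLast]

lemma reflLen_child_castSucc (u : Perm (Fin n)) (i : Fin n) :
    reflLen (child u i.castSucc) = reflLen u + 1 := by
  have := numCycles_le u
  simp only [reflLen, numCycles_child_castSucc]
  omega

end Children

section Statistics

open Equiv

variable {n : ℕ}

lemma totalDisp_extendLast (u : Perm (Fin n)) : totalDisp (extendLast u) = totalDisp u := by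
  simp [totalDisp, Fin.sum_univ_castSucc]

lemma totalDisp_child_castSucc (u : Perm (Fin n)) (i : Fin n) :
    totalDisp (child u i.castSucc) = totalDisp u + 2 * (n - max (i : ℕ) (u i)) := by
  have h : ∑ p ∈ Finset.univ.erase i,
      ((child u i.castSucc p.castSucc : ℤ) - (p.castSucc : ℕ)).natAbs =
      ∑ p ∈ Finset.univ.erase i, ((u p : ℤ) - (p : ℕ)).natAbs :=
    Finset.sum_congr rfl fun p hp => by
      rw [child_castSucc_of_ne u (Finset.ne_of_mem_erase hp)]
      simp
  have h1 := Finset.add_sum_erase Finset.univ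
    (fun p : Fin n => ((child u i.castSucc p.castSucc : ℤ) - (p.castSucc : ℕ)).natAbs)
    (Finset.mem_univ i)
  have h2 := Finset.add_sum_erase Finset.univ
    (fun p : Fin n => ((u p : ℤ) - (p : ℕ)).natAbs) (Finset.mem_univ i)
  simp only [child_apply_self, Fin.val_last, Fin.val_castSucc] at h1 h2 h
  simp only [totalDisp, Fin.sum_univ_castSucc, child_castSucc_last, Fin.val_last,
    Fin.val_castSucc]
  have := i.is_lt
  have := (u i).is_lt
  omega

lemma invLen_eq_sum (w : Perm (Fin n)) :
    (invLen w : ℤ) = ∑ p, ∑ q, if p < q ∧ w q < w p then 1 else 0 := by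
  rw [invLen, Finset.card_filter, Fintype.sum_prod_type]
  push_cast
  rfl

lemma invLen_succ (w : Perm (Fin (n + 1))) :
    (invLen w : ℤ) = (∑ p : Fin n, ∑ q : Fin n,
      if p < q ∧ w q.castSucc < w p.castSucc then 1 else 0) +
      ∑ p : Fin n, if w (Fin.last n) < w p.castSucc then 1 else 0 := by
  rw [invLen_eq_sum, Fin.sum_univ_castSucc]
  simp only [Fin.sum_univ_castSucc, Finset.sum_add_distrib, Fin.castSucc_lt_castSucc_iff,
    Fin.castSucc_lt_last, true_and, lt_irrefl, false_and, if_false, add_zero]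
  simp [not_lt.2 (Fin.le_last _)]

lemma invLen_extendLast (u : Perm (Fin n)) : invLen (extendLast u) = invLen u := by
  have h := invLen_succ (extendLast u)
  simp only [extendLast_castSucc, extendLast_last, Fin.castSucc_lt_castSucc_iff,
    not_lt.2 (Fin.le_last _), if_false, Finset.sum_const_zero, add_zero, ← invLen_eq_sum] at h
  exact_mod_cast h

/-- The positions to the right of `i` that carry an entry larger than `u i`. -/
def northEast (u : Perm (Fin n)) (i : Fin n) : Finset (Fin n) :=
  Finset.univ.filter fun q => i < q ∧ u i < u q

lemma invLen_child_castSucc (u : Perm (Fin n)) (i : Fin n) :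
    invLen (child u i.castSucc) = invLen u + 2 * (northEast u i).card + 1 := by
  have hM : ((northEast u i).card : ℤ) = ∑ q, if i < q ∧ u i < u q then 1 else 0 := by
    rw [northEast, Finset.card_filter]
    push_cast
    rfl
  have h1 : ∀ p q : Fin n, ((if p < q ∧ child u i.castSucc q.castSucc <
      child u i.castSucc p.castSucc then 1 else 0 : ℤ)) =
      (if p < q ∧ u q < u p then 1 else 0) +
      (if p = i then if i < q ∧ u i < u q then 1 else 0 else 0) -
      (if q = i then if p < i ∧ u i < u p then 1 else 0 else 0) := by
    intro p q
    by_cases hp : p = i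
    · subst hp
      by_cases hq : q = p
      · simp [hq]
      · have : u q ≠ u p := u.injective.ne hq
        rw [child_apply_self, child_castSucc_of_ne u hq]
        simp only [Fin.castSucc_lt_last, if_neg hq, if_true, and_true, sub_zero]
        rcases lt_or_gt_of_ne this with h | h <;> simp [h, h.not_gt]
    · by_cases hq : q = i
      · subst hq
        rw [child_apply_self, if_neg (not_lt.2 (Fin.le_last _) ∘ And.right), if_neg hp]
        simp
      · simp [child_castSucc_of_ne u hp, child_castSucc_of_ne u hq, hp, hq]
  have h2 : ∀ p : Fin n, ((if child u i.castSucc (Fin.last n) <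
      child u i.castSucc p.castSucc then 1 else 0 : ℤ)) =
      (if p = i then 1 else 0) + (if i < p ∧ u i < u p then 1 else 0) +
        (if p < i ∧ u i < u p then 1 else 0) := by
    intro p
    rw [child_castSucc_last]
    by_cases hp : p = i
    · subst hp
      simp [child_apply_self]
    · rw [child_castSucc_of_ne u hp]
      rcases lt_or_gt_of_ne hp with h | h <;> simp [h, h.not_gt, hp]
  have h := invLen_succ (child u i.castSucc)
  simp only [h1, h2, Finset.sum_add_distrib, Finset.sum_sub_distrib] at h
  rw [← invLen_eq_sum, Finset.sum_comm (f := fun p q => if p = i then _ else _)] at h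
  simp only [Finset.sum_ite_eq', Finset.mem_univ, if_true, ← hM] at h
  omega

lemma card_northEast_le_position (u : Perm (Fin n)) (i : Fin n) :
    (northEast u i).card + i + 1 ≤ n ∧
      ((northEast u i).card + i + 1 = n ↔ RightToLeftMinAt u i) := by
  have hsub : northEast u i ⊆ Finset.Ioi i := fun q hq => by
    simp only [northEast, Finset.mem_filter] at hq
    exact Finset.mem_Ioi.2 hq.2.1
  have hc : (Finset.Ioi i).card = n - 1 - i := Fin.card_Ioi i
  have hle := Finset.card_le_card hsub
  have hi := i.is_lt
  refine ⟨by omega, fun h q hq => ?_, fun h => ?_⟩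
  · have he := Finset.eq_of_subset_of_card_le hsub (by omega)
    have : q ∈ northEast u i := he ▸ Finset.mem_Ioi.2 hq
    simp only [northEast, Finset.mem_filter] at this
    exact this.2.2
  · have he : northEast u i = Finset.Ioi i := by
      ext q
      simpa [northEast] using h q
    rw [he]
    omega

lemma card_northEast_le_value (u : Perm (Fin n)) (i : Fin n) :
    (northEast u i).card + u i + 1 ≤ n ∧
      ((northEast u i).card + u i + 1 = n ↔ LeftToRightMaxAt u i) := by
  have hsub : (northEast u i).map u.toEmbedding ⊆ Finset.Ioi (u i) := fun q hq => by
    simp only [northEast, Finset.mem_map, Finset.mem_filter] at hq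
    obtain ⟨p, hp, rfl⟩ := hq
    exact Finset.mem_Ioi.2 hp.2.2
  have hc : (Finset.Ioi (u i)).card = n - 1 - u i := Fin.card_Ioi (u i)
  have hle := Finset.card_le_card hsub
  rw [Finset.card_map] at hle
  have hi := (u i).is_lt
  refine ⟨by omega, fun h q hq => ?_, fun h => ?_⟩
  · have he := Finset.eq_of_subset_of_card_le hsub (by rw [Finset.card_map]; omega)
    by_contra hlt
    have hlt2 : u i < u q := lt_of_le_of_ne (not_lt.1 hlt) (u.injective.ne hq.ne')
    have := he ▸ Finset.mem_Ioi.2 hlt2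
    simp only [northEast, Finset.mem_map_equiv, Equiv.symm_apply_apply, Finset.mem_filter] at this
    exact hq.not_gt this.2.1
  · have he : (northEast u i).map u.toEmbedding = Finset.Ioi (u i) := by
      refine hsub.antisymm fun y hy => ?_
      rw [Finset.mem_Ioi] at hy
      have h1 : i < u.symm y := by
        by_contra hlt
        rcases (not_lt.1 hlt).lt_or_eq with h2 | h2
        · have := h _ h2
          rw [Equiv.apply_symm_apply] at this
          exact this.not_gt hy
        · rw [← h2, Equiv.apply_symm_apply] at hy
          exact lt_irrefl _ hy
      simp [northEast, Finset.mem_map_equiv, h1, hy]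
    rw [← Finset.card_map u.toEmbedding, he]
    omega

/-- The positions `j` for which `child u j` is shallow whenever `u` is. -/
def IsActive (u : Perm (Fin n)) (j : Fin (n + 1)) : Prop :=
  ∀ i : Fin n, j = i.castSucc → LeftToRightMaxAt u i ∨ RightToLeftMinAt u i

lemma isActive_last (u : Perm (Fin n)) : IsActive u (Fin.last n) :=
  fun i hi => absurd hi (Fin.castSucc_lt_last i).ne'

lemma isActive_castSucc (u : Perm (Fin n)) (i : Fin n) :
    IsActive u i.castSucc ↔ LeftToRightMaxAt u i ∨ RightToLeftMinAt u i :=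
  ⟨fun h => h i rfl, fun h _ hk => Fin.castSucc_injective n hk ▸ h⟩

lemma invLen_add_reflLen_le (u : Perm (Fin n)) : invLen u + reflLen u ≤ totalDisp u := by
  induction n with
  | zero => simp [invLen, reflLen]
  | succ n ih =>
    obtain ⟨⟨v, j⟩, rfl⟩ := child_bijective.2 u
    have := ih v
    dsimp only
    induction j using Fin.lastCases with
    | last =>
      rwa [child_last, invLen_extendLast, reflLen_extendLast, totalDisp_extendLast]
    | cast i =>
      rw [invLen_child_castSucc, reflLen_child_castSucc, totalDisp_child_castSucc]
      have := (card_northEast_le_position v i).1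
      have := (card_northEast_le_value v i).1
      omega

lemma isShallow_child (u : Perm (Fin n)) (j : Fin (n + 1)) :
    IsShallow (child u j) ↔ IsShallow u ∧ IsActive u j := by
  induction j using Fin.lastCases with
  | last =>
    simp [IsShallow, invLen_extendLast, reflLen_extendLast, totalDisp_extendLast, isActive_last]
  | cast i =>
    have h := invLen_add_reflLen_le u
    have h1 := card_northEast_le_position u i
    have h2 := card_northEast_le_value u i
    rw [isActive_castSucc, ← h1.2, ← h2.2, IsShallow, IsShallow, invLen_child_castSucc,
      reflLen_child_castSucc, totalDisp_child_castSucc]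
    omega

end Statistics

section Counting

open Equiv

variable {n : ℕ}

/-- The number of shallow permutations of `Fin n`. -/
noncomputable def numShallow (n : ℕ) : ℕ :=
  Nat.card {w : Perm (Fin n) // IsShallow w}

open Classical in
/-- The number of permutations obtained from `u` by taking `k` times a child at an active
position. -/
noncomputable def numDescendants : ℕ → ∀ {n : ℕ}, Perm (Fin n) → ℕ
  | 0, _, _ => 1
  | k + 1, n, u => ∑ j : Fin (n + 1), if IsActive u j then numDescendants k (child u j) else 0

open Classical in
lemma sum_numDescendants (k : ℕ) : ∀ n : ℕ,
    ∑ u : Perm (Fin n), (if IsShallow u then numDescendants k u else 0) = numShallow (n + k) := by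
  induction k with
  | zero =>
    intro n
    simp [numDescendants, numShallow, Fintype.card_subtype]
  | succ k ih =>
    intro n
    rw [← add_assoc, add_right_comm, ← ih (n + 1),
      ← child_bijective.sum_comp fun w => if IsShallow w then numDescendants k w else 0,
      Fintype.sum_prod_type]
    refine Finset.sum_congr rfl fun u _ => ?_
    simp only [isShallow_child, numDescendants]
    split_ifs with h <;> simp [h]

lemma numShallow_eq_numDescendants (n : ℕ) :
    numShallow n = numDescendants n (1 : Perm (Fin 0)) := by
  have h := sum_numDescendants n 0
  rw [zero_add] at h
  rw [← h, Fintype.sum_unique, if_pos (by simp [IsShallow, invLen, reflLen, totalDisp])]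
  congr 1

/-- The left-to-right maxima and the right-to-left minima of `u` have components `s`. -/
def HasStaircase (u : Perm (Fin n)) (s : List ℕ) : Prop :=
  ∃ A C : List (ℕ × ℕ), Staircase s A C ∧
    (∀ q, q ∈ A ↔ ∃ j, LeftToRightMaxAt u j ∧ ((j : ℕ), (u j : ℕ)) = q) ∧
    ∀ q, q ∈ C ↔ ∃ j, RightToLeftMinAt u j ∧ ((j : ℕ), (u j : ℕ)) = q

lemma hasStaircase_nil (u : Perm (Fin 0)) : HasStaircase u [] :=
  ⟨[], [], .nil, by simp, by simp⟩

lemma HasStaircase.child_last {u : Perm (Fin n)} {s : List ℕ} (h : HasStaircase u s) :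
    HasStaircase (child u (Fin.last n)) (0 :: s) := by
  obtain ⟨A, C, hs, hA, hC⟩ := h
  refine ⟨(n, n) :: A, (n, n) :: C, hs.point _ ?_, fun q => ?_, fun q => ?_⟩
  · intro q hq
    rw [hA, hC] at hq
    rcases hq with ⟨j, -, rfl⟩ | ⟨j, -, rfl⟩ <;> exact ⟨j.is_lt, (u j).is_lt⟩
  · simp [hA, Fin.exists_fin_succ', LeftToRightMaxAt, Fin.forall_fin_succ', Fin.castSucc_lt_last,
      not_lt.2 (Fin.le_last _), or_comm, eq_comm]
  · simp [hC, Fin.exists_fin_succ', RightToLeftMinAt, Fin.forall_fin_succ', Fin.castSucc_lt_last,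
      not_lt.2 (Fin.le_last _), or_comm, eq_comm]

lemma leftToRightMaxAt_child_castSucc {u : Perm (Fin n)} {i p : Fin n} :
    LeftToRightMaxAt (child u i.castSucc) p.castSucc ↔ p = i ∨ p < i ∧ LeftToRightMaxAt u p := by
  rcases lt_trichotomy p i with h | rfl | h
  · simp only [h.ne, h, false_or, true_and, LeftToRightMaxAt, Fin.forall_fin_succ',
      Fin.castSucc_lt_castSucc_iff, child_castSucc_of_ne u h.ne,
      not_lt.2 (Fin.le_last _), false_imp_iff, and_true]
    refine forall₂_congr fun q hq => ?_
    rw [child_castSucc_of_ne u (hq.trans h).ne, Fin.castSucc_lt_castSucc_iff]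
  · simp only [true_or, iff_true]
    intro q hq
    rw [child_apply_self]
    refine lt_of_le_of_ne (Fin.le_last _) fun he => hq.ne ?_
    rw [← child_apply_self u p.castSucc] at he
    exact (child u p.castSucc).injective he
  · simp only [h.ne', h.not_gt, false_and, or_false, iff_false]
    intro hq
    have := hq i.castSucc (Fin.castSucc_lt_castSucc_iff.2 h)
    rw [child_apply_self] at this
    exact (Fin.le_last _).not_gt this

lemma not_leftToRightMaxAt_child_last (u : Perm (Fin n)) (i : Fin n) :
    ¬ LeftToRightMaxAt (child u i.castSucc) (Fin.last n) := fun h => by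
  have := h i.castSucc (Fin.castSucc_lt_last i)
  rw [child_apply_self] at this
  exact (Fin.le_last _).not_gt this

lemma rightToLeftMinAt_child_castSucc {u : Perm (Fin n)} {i p : Fin n} :
    RightToLeftMinAt (child u i.castSucc) p.castSucc ↔ u p < u i ∧ RightToLeftMinAt u p := by
  simp only [RightToLeftMinAt, Fin.forall_fin_succ', Fin.castSucc_lt_castSucc_iff,
    Fin.castSucc_lt_last, true_imp_iff, child_castSucc_last]
  rcases eq_or_ne p i with rfl | hp
  · simp [child_apply_self, not_lt.2 (Fin.le_last _)]
  · rw [child_castSucc_of_ne u hp, Fin.castSucc_lt_castSucc_iff, and_comm, and_congr_right_iff]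
    intro hlt
    refine forall₂_congr fun q _ => ?_
    rcases eq_or_ne q i with rfl | hq
    · simp [child_apply_self, hlt, Fin.castSucc_lt_last]
    · rw [child_castSucc_of_ne u hq, Fin.castSucc_lt_castSucc_iff]

lemma rightToLeftMinAt_last (w : Perm (Fin (n + 1))) : RightToLeftMinAt w (Fin.last n) :=
  fun _ h => absurd h (Fin.le_last _).not_gt

lemma hasStaircase_child_castSucc {u : Perm (Fin n)} {A C : List (ℕ × ℕ)}
    (hA : ∀ q, q ∈ A ↔ ∃ j, LeftToRightMaxAt u j ∧ ((j : ℕ), (u j : ℕ)) = q)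
    (hC : ∀ q, q ∈ C ↔ ∃ j, RightToLeftMinAt u j ∧ ((j : ℕ), (u j : ℕ)) = q)
    {i : Fin n} {c : List ℕ} (h : SplitAt n A C (i, u i) c) :
    HasStaircase (child u i.castSucc) c := by
  refine ⟨_, _, h, fun q => ?_, fun q => ?_⟩
  · simp only [List.mem_cons, List.mem_filter, decide_eq_true_eq, hA, Fin.exists_fin_succ',
      not_leftToRightMaxAt_child_last, false_and, or_false, leftToRightMaxAt_child_castSucc]
    constructor
    · rintro (rfl | ⟨⟨j, hj, rfl⟩, hji⟩)
      · exact ⟨i, .inl rfl, by simp [child_apply_self]⟩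
      · have hji : j < i := hji
        exact ⟨j, .inr ⟨hji, hj⟩, by simp [child_castSucc_of_ne u hji.ne]⟩
    · rintro ⟨j, rfl | ⟨hji, hj⟩, rfl⟩
      · simp [child_apply_self]
      · exact .inr ⟨⟨j, hj, by simp [child_castSucc_of_ne u hji.ne]⟩, hji⟩
  · simp only [List.mem_cons, List.mem_filter, decide_eq_true_eq, hC, Fin.exists_fin_succ',
      rightToLeftMinAt_last, true_and, rightToLeftMinAt_child_castSucc, child_castSucc_last]
    rw [or_comm, eq_comm]
    refine or_congr ⟨?_, ?_⟩ (by simp)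
    · rintro ⟨⟨j, hj, rfl⟩, hji⟩
      have hji : u j < u i := hji
      have hne : j ≠ i := fun h => hji.ne (congrArg u h)
      exact ⟨j, ⟨hji, hj⟩, by simp [child_castSucc_of_ne u hne]⟩
    · rintro ⟨j, ⟨hji, hj⟩, rfl⟩
      have hne : j ≠ i := fun h => hji.ne (congrArg u h)
      rw [child_castSucc_of_ne u hne]
      exact ⟨⟨j, hj, by simp⟩, hji⟩

lemma numDescendants_eq_countPaths (k : ℕ) : ∀ {n : ℕ} {u : Perm (Fin n)} {s : List ℕ},
    HasStaircase u s → numDescendants k u = countPaths k s := by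
  induction k with
  | zero => intros; rfl
  | succ k ih =>
    intro n u s h
    rw [numDescendants, Fin.sum_univ_castSucc, if_pos (isActive_last u), ih h.child_last,
      add_comm, countPaths, Nat.add_left_cancel_iff]
    obtain ⟨A, C, hs, hA, hC⟩ := h
    obtain ⟨T, hnd, hmem, hT, hsplit⟩ := hs.splits (n := n) fun q hq => by
      rw [hA, hC] at hq
      rcases hq with ⟨j, -, rfl⟩ | ⟨j, -, rfl⟩ <;> exact ⟨j.is_lt, (u j).is_lt⟩
    classical
    let F : ℕ × ℕ → ℕ := fun q =>
      if h : q.1 < n then numDescendants k (child u (Fin.castSucc ⟨q.1, h⟩)) else 0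
    have hF : ∀ i : Fin n, F (i, u i) = numDescendants k (child u i.castSucc) := fun i =>
      dif_pos i.is_lt
    have hmem2 : ∀ q, q ∈ T.map Prod.fst ↔ ∃ i : Fin n,
        IsActive u i.castSucc ∧ ((i : ℕ), (u i : ℕ)) = q :=
      fun q => by
        rw [hmem, hA, hC, ← exists_or]
        simp only [isActive_castSucc, or_and_right]
    have hset : (T.map Prod.fst).toFinset =
        (Finset.univ.filter fun i : Fin n => IsActive u i.castSucc).image
          fun i : Fin n => ((i : ℕ), (u i : ℕ)) := by
      ext q
      rw [List.mem_toFinset, hmem2]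
      simp
    have hsum : T.map (fun x => countPaths k x.2) = (T.map Prod.fst).map F := by
      rw [List.map_map]
      refine List.map_congr_left fun x hx => ?_
      obtain ⟨i, -, hi⟩ := (hmem2 x.1).1 (List.mem_map_of_mem hx)
      have hx2 := hsplit x hx
      rw [← hi] at hx2
      rw [Function.comp_apply, ← hi, hF, ih (hasStaircase_child_castSucc hA hC hx2)]
    rw [← hT, List.map_map, Function.comp_def, hsum, ← List.sum_toFinset F hnd, hset,
      Finset.sum_image fun i _ j _ hij => Fin.ext (Prod.ext_iff.1 hij).1,
      Finset.sum_filter]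
    exact Finset.sum_congr rfl fun i _ =>
      congrArg (fun x => if IsActive u i.castSucc then x else 0) (hF i).symm

lemma numShallow_eq_countPaths (n : ℕ) : numShallow n = countPaths n [] :=
  (numShallow_eq_numDescendants n).trans (numDescendants_eq_countPaths n (hasStaircase_nil 1))

end Counting

/-- The generating function `G = Σ a_n xⁿ` for the number `a_n` of shallow permutations
of `{1,…,n}` satisfies `x²G³ + (x² - 3x + 1)G² + (3x - 2)G + 1 = 0`. -/
theorem shallow_generating_function :
    let G : PowerSeries ℚ :=
      PowerSeries.mk fun n => (Nat.card {w : Equiv.Perm (Fin n) // IsShallow w} : ℚ)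
    PowerSeries.X ^ 2 * G ^ 3 + (PowerSeries.X ^ 2 - 3 * PowerSeries.X + 1) * G ^ 2
      + (3 * PowerSeries.X - 2) * G + 1 = 0 := by
  intro G
  have hG : G = pathSeries [] := by
    ext n
    simp only [G, pathSeries, PowerSeries.coeff_mk]
    exact_mod_cast numShallow_eq_countPaths n
  rw [hG]
  exact pathSeries_nil_cubic
end
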